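/- arXiv:2510.20689 — 2 statements merged into one kernel-verified Lean document; each statement's English description precedes it below -/
import Mathlib

section
/- Let A be an n×n matrix over a commutative ring K, and let χ_A = det(t·I_n − A) be its characteristic polynomial. Defining c_j = (coefficient of t^{n−j} in χ_A) for all integers j, we have k·c_k + Σ_{i=1}^{k} Tr(A^i)·c_{k−i} = 0 for every natural number k (the trace Cayley–Hamilton theorem). -/
open Polynomial Matrix

/-- The derivative of a determinant is the sum over the columns of the determinants obtained by
differentiating one column. -/
theorem derivative_det_eq_sum_updateCol {R m : Type*} [CommRing R] [Fintype m] [DecidableEq m]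
    (M : Matrix m m R[X]) :
    derivative M.det = ∑ i, (M.updateCol i fun j => derivative (M j i)).det := by
  simp only [det_apply, Units.smul_def, map_sum, map_zsmul, derivative_prod_finset]
  rw [Finset.sum_comm]
  refine Finset.sum_congr rfl fun σ _ => ?_
  rw [← Finset.smul_sum]
  congr 1
  refine Finset.sum_congr rfl fun i _ => ?_
  rw [← Finset.prod_erase_mul _ _ (Finset.mem_univ i), updateCol_self]
  congr 1
  refine Finset.prod_congr rfl fun j hj => ?_
  rw [updateCol_ne (Finset.ne_of_mem_erase hj)]

/-- The derivative of the characteristic polynomial is the trace of the adjugate of the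
characteristic matrix. -/
theorem derivative_charpoly_eq_trace_adjugate {R m : Type*} [CommRing R] [Fintype m]
    [DecidableEq m] (A : Matrix m m R) :
    derivative A.charpoly = (adjugate (charmatrix A)).trace := by
  rw [charpoly, derivative_det_eq_sum_updateCol, trace]
  refine Finset.sum_congr rfl fun i _ => ?_
  rw [diag_apply, ← transpose_apply (adjugate _), adjugate_transpose, adjugate_apply,
    updateRow_transpose, det_transpose]
  congr 2
  ext j
  by_cases h : j = i
  · subst h
    simp [charmatrix_apply_eq]
  · simp [h]

/-- The coefficients of the adjugate of the characteristic matrix satisfy the recursion of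
the Horner scheme for the characteristic polynomial. -/
theorem coeff_matPolyEquiv_adjugate_charmatrix {R m : Type*} [CommRing R] [Fintype m]
    [DecidableEq m] (A : Matrix m m R) (i : ℕ) :
    (matPolyEquiv (adjugate (charmatrix A))).coeff i =
      A.charpoly.coeff (i + 1) • (1 : Matrix m m R) +
        A * (matPolyEquiv (adjugate (charmatrix A))).coeff (i + 1) := by
  have h := congrArg (fun M => (matPolyEquiv M).coeff (i + 1)) (mul_adjugate (charmatrix A))
  simp only [map_mul, matPolyEquiv_charmatrix, sub_mul, coeff_sub, coeff_X_mul, coeff_C_mul] at h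
  rw [sub_eq_iff_eq_add] at h
  rw [h, ← charpoly, matPolyEquiv_smul_one, coeff_map, Algebra.algebraMap_eq_smul_one]

/-- The recursion for the coefficients of the adjugate of the characteristic matrix, iterated
`N` times. -/
theorem coeff_matPolyEquiv_adjugate_charmatrix_eq_sum {R m : Type*} [CommRing R] [Fintype m]
    [DecidableEq m] (A : Matrix m m R) (i N : ℕ) :
    (matPolyEquiv (adjugate (charmatrix A))).coeff i =
      ∑ j ∈ Finset.range N, A.charpoly.coeff (i + 1 + j) • A ^ j +
        A ^ N * (matPolyEquiv (adjugate (charmatrix A))).coeff (i + N) := by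
  induction N with
  | zero => simp
  | succ N ih =>
    rw [ih, coeff_matPolyEquiv_adjugate_charmatrix A (i + N), Finset.sum_range_succ, mul_add,
      ← mul_assoc, ← pow_succ, mul_smul_comm, mul_one, add_assoc,
      add_right_comm i 1 N, ← add_assoc, add_assoc i N 1]

/-- The coefficients of the adjugate of the characteristic matrix in terms of the powers of the
matrix. -/
theorem coeff_matPolyEquiv_adjugate_charmatrix_eq_sum_range {R m : Type*} [CommRing R]
    [Fintype m] [DecidableEq m] (A : Matrix m m R) (i N : ℕ) (h : Fintype.card m ≤ i + N) :
    (matPolyEquiv (adjugate (charmatrix A))).coeff i =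
      ∑ j ∈ Finset.range N, A.charpoly.coeff (i + 1 + j) • A ^ j := by
  nontriviality R
  have hz (j : ℕ) (hj : N ≤ j) : A.charpoly.coeff (i + 1 + j) = 0 :=
    coeff_eq_zero_of_natDegree_lt (by rw [charpoly_natDegree_eq_dim]; omega)
  set B := matPolyEquiv (adjugate (charmatrix A))
  rw [coeff_matPolyEquiv_adjugate_charmatrix_eq_sum A i (N + (B.natDegree + 1)),
    coeff_eq_zero_of_natDegree_lt (p := B) (by omega), mul_zero, add_zero]
  refine (Finset.sum_subset (by simp) fun j _ hj => ?_).symm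
  rw [hz j (by simpa using hj), zero_smul]

theorem trace_coeff_matPolyEquiv_adjugate_charmatrix {R m : Type*} [CommRing R]
    [Fintype m] [DecidableEq m] (A : Matrix m m R) (i : ℕ) :
    ((matPolyEquiv (adjugate (charmatrix A))).coeff i).trace =
      A.charpoly.coeff (i + 1) * (i + 1) := by
  rw [← coeff_derivative, derivative_charpoly_eq_trace_adjugate, trace, trace, finsetSum_coeff]
  simp [matPolyEquiv_coeff_apply]

/-- The traces of the powers of a matrix satisfy the linear recurrence given by its characteristic
polynomial. -/
theorem sum_coeff_charpoly_mul_trace_pow {R m : Type*} [CommRing R] [Fintype m] [DecidableEq m]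
    (A : Matrix m m R) (d : ℕ) :
    ∑ i ∈ Finset.range (Fintype.card m + 1), A.charpoly.coeff i * (A ^ (d + i)).trace = 0 := by
  nontriviality R
  have h := congrArg (fun M => (A ^ d * M).trace) (aeval_self_charpoly A)
  simpa [aeval_eq_sum_range, charpoly_natDegree_eq_dim, Finset.mul_sum, trace_sum, ← pow_add]
    using h

theorem stmt_1 (K : Type*) [CommRing K] (n : ℕ)
    (A : Matrix (Fin n) (Fin n) K) (c : ℕ → K)
    (hc : ∀ j : ℕ, c j = if j ≤ n then (Matrix.charpoly A).coeff (n - j) else 0) :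
    ∀ k : ℕ, (k : K) * c k + ∑ i ∈ Finset.Icc 1 k, Matrix.trace (A ^ i) * c (k - i) = 0 := by
  intro k
  have hsplit : ∑ i ∈ Finset.range (k + 1), trace (A ^ i) * c (k - i) =
      n * c k + ∑ i ∈ Finset.Icc 1 k, trace (A ^ i) * c (k - i) := by
    rw [Finset.range_eq_Ico, Finset.sum_eq_sum_Ico_succ_bot (by omega)]
    simp [Finset.Ico_add_one_right_eq_Icc]
  rcases lt_or_ge k n with hk | hk
  · have h := trace_coeff_matPolyEquiv_adjugate_charmatrix A (n - k - 1)
    rw [coeff_matPolyEquiv_adjugate_charmatrix_eq_sum_range A (n - k - 1) (k + 1)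
      (by rw [Fintype.card_fin]; omega), trace_sum] at h
    have hsum : ∑ i ∈ Finset.range (k + 1), trace (A ^ i) * c (k - i) = c k * (n - k) := by
      have hcast : ((n - k - 1 : ℕ) : K) + 1 = n - k := by
        rw [← Nat.cast_sub hk.le, ← Nat.cast_add_one]
        congr 1
        omega
      rw [hcast, show n - k - 1 + 1 = n - k by omega] at h
      rw [hc k, if_pos hk.le, ← h]
      refine Finset.sum_congr rfl fun i hi => ?_
      have hi' := Finset.mem_range.mp hi
      rw [hc, if_pos (by omega), trace_smul, smul_eq_mul, mul_comm,
        show n - (k - i) = n - k + i by omega]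
    linear_combination hsum - hsplit
  · have hsum : ∑ i ∈ Finset.range (k + 1), trace (A ^ i) * c (k - i) = 0 := by
      have h := sum_coeff_charpoly_mul_trace_pow A (k - n)
      rw [Fintype.card_fin] at h
      rw [← Nat.sub_add_cancel hk, add_assoc, Finset.sum_range_add, Nat.sub_add_cancel hk,
        Finset.sum_eq_zero, zero_add, ← h]
      · refine Finset.sum_congr rfl fun i hi => ?_
        have hi' := Finset.mem_range.mp hi
        rw [hc, if_pos (by omega), mul_comm, show n - (k - (k - n + i)) = i by omega]
      · intro i hi
        have hi' := Finset.mem_range.mp hi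
        rw [hc, if_neg (by omega), mul_zero]
    have hnk : (k : K) * c k = n * c k := by
      rcases hk.eq_or_lt with rfl | hlt
      · rfl
      · rw [hc k, if_neg (by omega), mul_zero, mul_zero]
    linear_combination hsum - hsplit + hnk
end

section
/- Let K be a commutative Q-algebra and A an n×n matrix over K such that Tr(A^i) = 0 for every i ∈ {1, 2, ..., n}. Then A^n = 0. -/
open Matrix

/-- **Jacobi's formula** for polynomial matrices. -/
theorem derivative_det_eq_trace_adjugate_mul {ι R : Type*} [Fintype ι] [DecidableEq ι]
    [CommRing R] (M : Matrix ι ι (Polynomial R)) :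
    Polynomial.derivative M.det = (M.adjugate * M.map Polynomial.derivative).trace := by
  have key (i : ι) : (M.adjugate * M.map Polynomial.derivative) i i =
      (M.updateCol i fun j => Polynomial.derivative (M j i)).det := by
    rw [← cramer_apply, cramer_eq_adjugate_mulVec]
    rfl
  simp only [trace, diag_apply, key]
  simp only [det_apply, Polynomial.derivative_sum, Polynomial.derivative_smul]
  rw [Finset.sum_comm]
  refine Finset.sum_congr rfl fun σ _ => ?_
  rw [← Finset.smul_sum, Polynomial.derivative_prod_finset]
  congr 1
  refine Finset.sum_congr rfl fun i _ => ?_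
  rw [← Finset.prod_erase_mul _ _ (Finset.mem_univ i)]
  congr 1
  · refine Finset.prod_congr rfl fun j hj => ?_
    rw [updateCol_ne (Finset.ne_of_mem_erase hj)]
  · simp

/-- A truncated form of the logarithmic derivative of the reversed characteristic polynomial. -/
theorem X_pow_dvd_derivative_charpolyRev_add {ι R : Type*} [Fintype ι] [DecidableEq ι]
    [CommRing R] (A : Matrix ι ι R) (m : ℕ) :
    (Polynomial.X : Polynomial R) ^ m ∣ Polynomial.derivative A.charpolyRev +
      A.charpolyRev * ∑ i ∈ Finset.range m,
        Polynomial.X ^ i * Polynomial.C (A ^ (i + 1)).trace := by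
  set B : Matrix ι ι (Polynomial R) := A.map Polynomial.C with hB
  set N : Matrix ι ι (Polynomial R) := 1 - (Polynomial.X : Polynomial R) • B with hN
  have hdet : A.charpolyRev = N.det := rfl
  have hder : N.map Polynomial.derivative = -B := by
    ext1 i j
    by_cases hij : i = j <;> simp [hN, hB, one_apply, hij]
  have hpow (k : ℕ) : (B ^ k).trace = Polynomial.C (A ^ k).trace := by
    rw [hB, ← RingHom.mapMatrix_apply, ← map_pow, RingHom.mapMatrix_apply]
    simp [trace]
  have hgeom : N * ∑ i ∈ Finset.range m, ((Polynomial.X : Polynomial R) • B) ^ i =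
      1 - ((Polynomial.X : Polynomial R) • B) ^ m := mul_neg_geom_sum _ _
  have hadj : N.adjugate = N.det • (∑ i ∈ Finset.range m, (Polynomial.X ^ i : Polynomial R) • B ^ i)
      + (Polynomial.X ^ m : Polynomial R) • (N.adjugate * B ^ m) := by
    have := congrArg (N.adjugate * ·) hgeom
    simp only [← mul_assoc, adjugate_mul, mul_sub, smul_mul_assoc, one_mul, mul_one, smul_pow,
      mul_smul_comm] at this
    rw [this, sub_add_cancel]
  refine ⟨-(N.adjugate * B ^ m * B).trace, ?_⟩
  rw [hdet, derivative_det_eq_trace_adjugate_mul, hder, mul_neg, trace_neg]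
  conv_lhs => enter [1, 1]; rw [hadj]
  simp only [add_mul, smul_mul_assoc, trace_add, trace_smul, Finset.sum_mul, trace_sum, ← pow_succ,
    hpow, smul_eq_mul]
  ring

theorem charpolyRev_eq_one_of_trace_pow_eq_zero {ι R : Type*} [Fintype ι] [DecidableEq ι]
    [CommRing R] [Algebra ℚ R] (A : Matrix ι ι R)
    (h : ∀ i ∈ Finset.Icc 1 (Fintype.card ι), (A ^ i).trace = 0) : A.charpolyRev = 1 := by
  nontriviality R
  have hdvd := X_pow_dvd_derivative_charpolyRev_add A (Fintype.card ι)
  rw [Finset.sum_eq_zero fun i hi => by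
    rw [h (i + 1) (by simp at hi ⊢; lia), map_zero, mul_zero], mul_zero, add_zero,
    Polynomial.X_pow_dvd_iff] at hdvd
  have hdeg : A.charpolyRev.natDegree ≤ Fintype.card ι := by
    rw [← reverse_charpoly, ← A.charpoly_natDegree_eq_dim]
    exact Polynomial.reverse_natDegree_le _
  ext k
  rcases k with _ | k
  · simp [Polynomial.coeff_zero_eq_eval_zero]
  · rw [Polynomial.coeff_one, if_neg k.succ_ne_zero]
    rcases lt_or_ge k (Fintype.card ι) with hk | hk
    · have hz := hdvd k hk
      rw [Polynomial.coeff_derivative] at hz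
      have hu : IsUnit ((k : R) + 1) := by
        have := (IsUnit.mk0 ((k : ℚ) + 1) (by positivity)).map (algebraMap ℚ R)
        simpa using this
      exact hu.mul_left_eq_zero.mp hz
    · exact Polynomial.coeff_eq_zero_of_natDegree_lt (by lia)

theorem charpoly_eq_X_pow_of_charpolyRev_eq_one {ι R : Type*} [Fintype ι] [DecidableEq ι]
    [CommRing R] {A : Matrix ι ι R} (h : A.charpolyRev = 1) :
    A.charpoly = Polynomial.X ^ Fintype.card ι := by
  nontriviality R
  rw [← reverse_charpoly, Polynomial.reverse, charpoly_natDegree_eq_dim] at h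
  rw [← Polynomial.reflect_one, ← h, Polynomial.reflect_reflect]

theorem stmt_6 (K : Type*) [CommRing K] [Algebra ℚ K] (n : ℕ)
    (A : Matrix (Fin n) (Fin n) K)
    (h : ∀ i ∈ Finset.Icc 1 n, Matrix.trace (A ^ i) = 0) :
    A ^ n = 0 := by
  have hchar := charpoly_eq_X_pow_of_charpolyRev_eq_one
    (charpolyRev_eq_one_of_trace_pow_eq_zero A (by simpa using h))
  simpa [hchar] using aeval_self_charpoly A
end
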